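/- For every α₀, β₀ ∈ ℝ, the function ψ is differentiable at all but finitely many points of pr₂𝒟, and ∫_{pr₂𝒟} |ψ′(x)| dx ≤ √2 + ln(1 + √2). -/

import Mathlib

open MeasureTheory Real

/-- `Φ_{α₀,β₀}(t,x) = 1 + t² - (β₀ - tα₀ + x)²`. -/
def Phi (α0 β0 t x : ℝ) : ℝ := 1 + t ^ 2 - (β0 - t * α0 + x) ^ 2

/-- The domain `𝒟_{α₀,β₀} = {(t,x) : 0 ≤ t ≤ 1, Φ(t,x) ≥ 0}`. -/
def Dom (α0 β0 : ℝ) : Set (ℝ × ℝ) :=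
  {p | 0 ≤ p.1 ∧ p.1 ≤ 1 ∧ 0 ≤ Phi α0 β0 p.1 p.2}

/-- The projection `pr₂𝒟` of `𝒟` on the second coordinate. -/
def pr2Dom (α0 β0 : ℝ) : Set ℝ := Prod.snd '' Dom α0 β0

/-- The `x`-section `I_x = {t ∈ [0,1] : Φ(t,x) ≥ 0}`. -/
def Isec (α0 β0 x : ℝ) : Set ℝ := {t | t ∈ Set.Icc (0 : ℝ) 1 ∧ 0 ≤ Phi α0 β0 t x}

/-- `ψ(x) = ∫_{I_x} √(Φ(t,x)) dt`. -/
noncomputable def psi (α0 β0 x : ℝ) : ℝ :=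
  ∫ t in Isec α0 β0 x, Real.sqrt (Phi α0 β0 t x)

section Kernel

variable {R : ℝ}

lemma hasDerivAt_neg_sqrt_sub_sq {u : ℝ} (hu : R - u ^ 2 ≠ 0) :
    HasDerivAt (fun v => -√(R - v ^ 2)) (u / √(R - u ^ 2)) u := by
  have h : HasDerivAt (fun v : ℝ => R - v ^ 2) (-(2 * u)) u := by
    simpa using (hasDerivAt_pow 2 u).const_sub R
  refine (h.sqrt hu).fun_neg.congr_deriv ?_
  rw [neg_div, neg_neg, mul_div_mul_left _ _ two_ne_zero]

lemma intervalIntegrable_div_sqrt_sub_sq_zero_sqrt :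
    IntervalIntegrable (fun u => u / √(R - u ^ 2)) volume 0 √R := by
  have hr : 0 ≤ √R := sqrt_nonneg R
  refine intervalIntegral.intervalIntegrable_deriv_of_nonneg (g := fun v => -√(R - v ^ 2))
    (by fun_prop) (fun u hu => ?_) (fun u hu => ?_)
  · rw [min_eq_left hr, max_eq_right hr] at hu
    have : u ^ 2 < R := (lt_sqrt hu.1.le).1 hu.2
    exact hasDerivAt_neg_sqrt_sub_sq (sub_ne_zero.2 this.ne')
  · rw [min_eq_left hr, max_eq_right hr] at hu
    exact div_nonneg hu.1.le (sqrt_nonneg _)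

lemma div_sqrt_sub_sq_eq_zero {u : ℝ} (hu : √R ≤ |u|) : u / √(R - u ^ 2) = 0 := by
  have : R ≤ u ^ 2 := by
    rw [← sq_abs]
    exact (sqrt_le_left (abs_nonneg u)).1 hu
  rw [sqrt_eq_zero_of_nonpos (sub_nonpos.2 this), div_zero]

lemma integrable_div_sqrt_sub_sq :
    Integrable (fun u => u / √(R - u ^ 2)) := by
  have hr : 0 ≤ √R := sqrt_nonneg R
  have h₁ := intervalIntegrable_div_sqrt_sub_sq_zero_sqrt (R := R)
  have h₂ : IntervalIntegrable (fun u => u / √(R - u ^ 2)) volume (-√R) 0 := by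
    have := (h₁.comp_sub_left 0).neg.symm
    simpa [neg_div, Function.comp_def, Pi.neg_def] using this
  have h₃ := h₂.trans h₁
  rw [intervalIntegrable_iff_integrableOn_Ioc_of_le (by linarith)] at h₃
  refine (integrableOn_iff_integrable_of_support_subset fun u hu => ?_).1 h₃
  have : |u| < √R := lt_of_not_ge fun h => hu (div_sqrt_sub_sq_eq_zero h)
  exact ⟨(abs_lt.1 this).1, (abs_lt.1 this).2.le⟩

lemma integral_norm_div_sqrt_sub_sq (hR : 0 ≤ R) :
    ∫ u, ‖u / √(R - u ^ 2)‖ = 2 * √R := by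
  have hr : 0 ≤ √R := sqrt_nonneg R
  have h : ∀ u : ℝ, ‖u / √(R - u ^ 2)‖ = (fun v => v / √(R - v ^ 2)) |u| := fun u => by
    simp [abs_of_nonneg (sqrt_nonneg _)]
  rw [integral_congr_ae (.of_forall h), integral_comp_abs (f := fun v => v / √(R - v ^ 2)),
    setIntegral_eq_of_subset_of_forall_sdiff_eq_zero measurableSet_Ioi
      (Set.Ioc_subset_Ioi_self : Set.Ioc 0 √R ⊆ Set.Ioi 0),
    ← intervalIntegral.integral_of_le hr,
    intervalIntegral.integral_eq_sub_of_hasDerivAt_of_le (f := fun v => -√(R - v ^ 2)) hr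
      (by fun_prop) _ intervalIntegrable_div_sqrt_sub_sq_zero_sqrt]
  · simp [sq_sqrt hR]
  · intro u hu
    have : u ^ 2 < R := (lt_sqrt hu.1.le).1 hu.2
    exact hasDerivAt_neg_sqrt_sub_sq (sub_ne_zero.2 this.ne')
  · rintro u ⟨hu₀, hu⟩
    refine div_sqrt_sub_sq_eq_zero ?_
    have hu₁ : 0 < u := hu₀
    rw [abs_of_pos hu₁]
    exact le_of_lt (by simpa [hu₁] using hu)

lemma integral_div_sqrt_sub_sq (hR : 0 < R) (a b : ℝ) :
    ∫ u in a..b, u / √(R - u ^ 2) = √(R - a ^ 2) - √(R - b ^ 2) := by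
  have := integral_eq_of_hasDerivAt_off_countable (fun v => -√(R - v ^ 2))
    (fun u => u / √(R - u ^ 2)) (a := a) (b := b) (s := {√R, -√R})
    (Set.toFinite _).countable (by fun_prop)
    (fun u hu => by
      have : R - u ^ 2 ≠ 0 := fun h => hu.2 <| by
        have : u ^ 2 = √R ^ 2 := by rw [sq_sqrt hR.le]; linarith
        simpa using sq_eq_sq_iff_eq_or_eq_neg.1 this
      exact hasDerivAt_neg_sqrt_sub_sq this)
    integrable_div_sqrt_sub_sq.intervalIntegrable
  rw [this]
  ring

end Kernel

lemma integral_two_mul_sqrt_one_add_sq :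
    ∫ t in (0 : ℝ)..1, 2 * √(1 + t ^ 2) = √2 + log (1 + √2) := by
  rw [intervalIntegral.integral_eq_sub_of_hasDerivAt
    (f := fun t => t * √(1 + t ^ 2) + arsinh t) (fun t _ => ?_)
    (Continuous.intervalIntegrable (by fun_prop) _ _)]
  · norm_num [arsinh]
  · have hpos : 0 < 1 + t ^ 2 := by positivity
    have h : HasDerivAt (fun v : ℝ => 1 + v ^ 2) (2 * t) t := by
      simpa using (hasDerivAt_pow 2 t).const_add 1
    refine (((hasDerivAt_id t).mul (h.sqrt hpos.ne')).add (hasDerivAt_arsinh t)).congr_deriv ?_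
    have hs : √(1 + t ^ 2) ≠ 0 := (sqrt_pos.2 hpos).ne'
    have hsq := sq_sqrt hpos.le
    simp only [id]
    field_simp
    rw [hsq]
    ring

section Phi

variable (α0 β0 : ℝ)

lemma psi_eq_intervalIntegral (x : ℝ) : psi α0 β0 x = ∫ t in (0 : ℝ)..1, √(Phi α0 β0 t x) := by
  rw [psi, intervalIntegral.integral_of_le zero_le_one, ← integral_Icc_eq_integral_Ioc]
  refine (setIntegral_eq_of_subset_of_forall_sdiff_eq_zero measurableSet_Icc
    (fun t ht => ht.1) fun t ht => ?_).symm
  exact sqrt_eq_zero_of_nonpos (le_of_not_ge fun h => ht.2 ⟨ht.1, h⟩)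

/-- The partial derivative in `x` of `√(Phi α0 β0 t x)`. -/
noncomputable def sqrtPhiDeriv (t x : ℝ) : ℝ := -((β0 - t * α0 + x) / √(Phi α0 β0 t x))

lemma integral_norm_sqrtPhiDeriv (t : ℝ) :
    ∫ x, ‖sqrtPhiDeriv α0 β0 t x‖ = 2 * √(1 + t ^ 2) := by
  rw [← integral_norm_div_sqrt_sub_sq (by positivity : (0 : ℝ) ≤ 1 + t ^ 2),
    ← integral_add_left_eq_self (fun u => ‖u / √(1 + t ^ 2 - u ^ 2)‖) (β0 - t * α0)]
  simp [sqrtPhiDeriv, Phi]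

lemma integrable_sqrtPhiDeriv (t : ℝ) : Integrable (sqrtPhiDeriv α0 β0 t) :=
  ((integrable_div_sqrt_sub_sq (R := 1 + t ^ 2)).comp_add_left (β0 - t * α0)).neg

lemma integral_sqrtPhiDeriv (t a b : ℝ) :
    ∫ x in a..b, sqrtPhiDeriv α0 β0 t x = √(Phi α0 β0 t b) - √(Phi α0 β0 t a) := by
  simp only [sqrtPhiDeriv, Phi, intervalIntegral.integral_neg]
  rw [intervalIntegral.integral_comp_add_left (fun u => u / √(1 + t ^ 2 - u ^ 2)),
    integral_div_sqrt_sub_sq (by positivity)]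
  ring

lemma measurable_uncurry_sqrtPhiDeriv :
    Measurable (Function.uncurry (sqrtPhiDeriv α0 β0)) := by
  unfold sqrtPhiDeriv Phi Function.uncurry
  fun_prop

lemma integrable_uncurry_sqrtPhiDeriv :
    Integrable (Function.uncurry (sqrtPhiDeriv α0 β0))
      ((volume.restrict (Set.Ioc 0 1)).prod volume) := by
  refine (integrable_prod_iff (measurable_uncurry_sqrtPhiDeriv α0 β0).aestronglyMeasurable).2
    ⟨.of_forall fun t => integrable_sqrtPhiDeriv α0 β0 t, ?_⟩
  simp only [Function.uncurry_apply_pair, integral_norm_sqrtPhiDeriv]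
  exact (Continuous.integrableOn_Ioc (by fun_prop))

lemma integrable_integral_sqrtPhiDeriv :
    Integrable (fun x => ∫ t in Set.Ioc 0 1, sqrtPhiDeriv α0 β0 t x) :=
  (integrable_uncurry_sqrtPhiDeriv α0 β0).integral_prod_right

lemma psi_sub_psi (a b : ℝ) :
    psi α0 β0 b - psi α0 β0 a = ∫ x in a..b, ∫ t in Set.Ioc 0 1, sqrtPhiDeriv α0 β0 t x := by
  have hc : ∀ x, Continuous fun t => √(Phi α0 β0 t x) := fun x => by unfold Phi; fun_prop
  rw [psi_eq_intervalIntegral, psi_eq_intervalIntegral,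
    ← intervalIntegral.integral_sub ((hc b).intervalIntegrable _ _)
      ((hc a).intervalIntegrable _ _), intervalIntegral_integral_swap]
  · rw [intervalIntegral.integral_of_le zero_le_one]
    simp only [integral_sqrtPhiDeriv]
  · refine ((integrable_uncurry_sqrtPhiDeriv α0 β0).swap.mono_measure ?_)
    exact Measure.prod_mono Measure.restrict_le_self le_rfl

/-- The quarter discriminant of `t ↦ Phi α0 β0 t x`. -/
def phiDiscr (x : ℝ) : ℝ := (β0 + x) ^ 2 + α0 ^ 2 - 1

lemma finite_phiDiscr_eq_zero : {x | phiDiscr α0 β0 x = 0}.Finite := by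
  refine (Set.toFinite {√(1 - α0 ^ 2) - β0, -√(1 - α0 ^ 2) - β0}).subset fun x hx => ?_
  have hx : (β0 + x) ^ 2 + α0 ^ 2 - 1 = 0 := hx
  have h : (β0 + x) ^ 2 = √(1 - α0 ^ 2) ^ 2 := by
    rw [sq_sqrt (by nlinarith [sq_nonneg (β0 + x)])]; linarith
  rcases sq_eq_sq_iff_eq_or_eq_neg.1 h with h | h
  · exact .inl (by linarith)
  · exact .inr (Set.mem_singleton_iff.2 (by linarith))

/-- Half the derivative in `t` of `Phi α0 β0 t x`. -/
def halfPhiDeriv (t x : ℝ) : ℝ := t + α0 * (β0 - t * α0 + x)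

lemma halfPhiDeriv_sq (t x : ℝ) :
    halfPhiDeriv α0 β0 t x ^ 2 = (1 - α0 ^ 2) * Phi α0 β0 t x + phiDiscr α0 β0 x := by
  unfold halfPhiDeriv Phi phiDiscr
  ring

lemma hasDerivAt_Phi (t x : ℝ) :
    HasDerivAt (fun t => Phi α0 β0 t x) (2 * halfPhiDeriv α0 β0 t x) t := by
  have h₁ : HasDerivAt (fun t => β0 - t * α0 + x) (-α0) t := by
    simpa using (((hasDerivAt_id t).mul_const α0).const_sub β0).add_const x
  have h₂ : HasDerivAt (fun t : ℝ => 1 + t ^ 2) (2 * t) t := by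
    simpa using (hasDerivAt_pow 2 t).const_add 1
  refine (h₂.sub (h₁.pow 2)).congr_deriv ?_
  simp [halfPhiDeriv]
  ring

lemma finite_Phi_eq_zero {x : ℝ} (hx : phiDiscr α0 β0 x ≠ 0) :
    {t | Phi α0 β0 t x = 0}.Finite := by
  let p : Polynomial ℝ := .C (1 - α0 ^ 2) * .X ^ 2 + .C (2 * α0 * (β0 + x)) * .X
    + .C (1 - (β0 + x) ^ 2)
  have hp : ∀ t, p.eval t = Phi α0 β0 t x := fun t => by simp [p, Phi]; ring
  have hp₀ : p ≠ 0 := fun h => hx <| by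
    have hz : ∀ t, Phi α0 β0 t x = 0 := fun t => by rw [← hp, h, Polynomial.eval_zero]
    have h₀ := hz 0
    have h₁ := hz 1
    have h₂ := hz (-1)
    unfold Phi at h₀ h₁ h₂
    unfold phiDiscr
    nlinarith
  refine (p.rootSet_finite ℝ).subset fun t ht => ?_
  rw [Polynomial.mem_rootSet]
  exact ⟨hp₀, by simpa [hp] using ht⟩

/-- The antiderivative in `t` used to remove the singularity of `sqrtPhiDeriv`. -/
noncomputable def phiBoundary (t x : ℝ) : ℝ :=
  -(halfPhiDeriv α0 β0 t x * (β0 - t * α0 + x)) * √(Phi α0 β0 t x)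

/-- The regular part of the derivative of `phiBoundary` in `t`. -/
noncomputable def phiRegular (t x : ℝ) : ℝ :=
  (α0 * halfPhiDeriv α0 β0 t x - 2 * (1 - α0 ^ 2) * (β0 - t * α0 + x)) * √(Phi α0 β0 t x)

lemma hasDerivAt_phiBoundary {t x : ℝ} (h : Phi α0 β0 t x ≠ 0) :
    HasDerivAt (fun t => phiBoundary α0 β0 t x)
      (phiRegular α0 β0 t x + phiDiscr α0 β0 x * sqrtPhiDeriv α0 β0 t x) t := by
  have h₁ : HasDerivAt (fun t => β0 - t * α0 + x) (-α0) t := by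
    simpa using (((hasDerivAt_id t).mul_const α0).const_sub β0).add_const x
  have h₂ : HasDerivAt (fun t => halfPhiDeriv α0 β0 t x) (1 + α0 * -α0) t :=
    (hasDerivAt_id t).add (h₁.const_mul α0)
  refine ((h₂.mul h₁).neg.mul ((hasDerivAt_Phi α0 β0 t x).sqrt h)).congr_deriv ?_
  have hD : phiDiscr α0 β0 x =
      halfPhiDeriv α0 β0 t x ^ 2 - (1 - α0 ^ 2) * Phi α0 β0 t x := by
    rw [halfPhiDeriv_sq]; ring
  rw [hD, phiRegular, sqrtPhiDeriv]
  rcases lt_or_gt_of_ne h with h | h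
  · simp [sqrt_eq_zero_of_nonpos h.le]
  · have hs : √(Phi α0 β0 t x) ≠ 0 := (sqrt_pos.2 h).ne'
    have hsq := sq_sqrt h.le
    simp only [Pi.neg_apply, Pi.mul_apply]
    field_simp
    rw [hsq]
    ring

/-- A continuous expression for the derivative of `psi` off the zeros of `phiDiscr`. -/
noncomputable def psiDeriv (x : ℝ) : ℝ :=
  (phiBoundary α0 β0 1 x - phiBoundary α0 β0 0 x - ∫ t in (0 : ℝ)..1, phiRegular α0 β0 t x) /
    phiDiscr α0 β0 x

lemma continuousAt_psiDeriv {x : ℝ} (hx : phiDiscr α0 β0 x ≠ 0) :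
    ContinuousAt (psiDeriv α0 β0) x := by
  refine ContinuousAt.div (Continuous.continuousAt ?_) (Continuous.continuousAt ?_) hx
  · refine Continuous.sub ?_
      (intervalIntegral.continuous_parametric_intervalIntegral_of_continuous' ?_ 0 1)
    · unfold phiBoundary halfPhiDeriv Phi
      fun_prop
    · unfold phiRegular halfPhiDeriv Phi Function.uncurry
      fun_prop
  · unfold phiDiscr
    fun_prop

lemma integral_sqrtPhiDeriv_ae_eq :
    (fun x => ∫ t in Set.Ioc 0 1, sqrtPhiDeriv α0 β0 t x) =ᵐ[volume] psiDeriv α0 β0 := by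
  filter_upwards [(integrable_uncurry_sqrtPhiDeriv α0 β0).prod_left_ae,
    (finite_phiDiscr_eq_zero α0 β0).measure_zero volume |> compl_mem_ae_iff.2] with x hint hx
  have hx : phiDiscr α0 β0 x ≠ 0 := hx
  have hi : IntervalIntegrable (fun t => sqrtPhiDeriv α0 β0 t x) volume 0 1 :=
    (intervalIntegrable_iff_integrableOn_Ioc_of_le zero_le_one).2 hint
  have hr : IntervalIntegrable (fun t => phiRegular α0 β0 t x) volume 0 1 :=
    Continuous.intervalIntegrable (by unfold phiRegular halfPhiDeriv Phi; fun_prop) _ _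
  have key := integral_eq_of_hasDerivAt_off_countable (fun t => phiBoundary α0 β0 t x) _
    (finite_Phi_eq_zero α0 β0 hx).countable
    (by unfold phiBoundary halfPhiDeriv Phi; fun_prop)
    (fun t ht => hasDerivAt_phiBoundary α0 β0 ht.2) (hr.add (hi.const_mul _))
  simp only [intervalIntegral.integral_add hr (hi.const_mul _),
    intervalIntegral.integral_const_mul] at key
  rw [psiDeriv, ← intervalIntegral.integral_of_le zero_le_one, eq_div_iff hx]
  linarith

lemma hasDerivAt_psi {x : ℝ} (hx : phiDiscr α0 β0 x ≠ 0) :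
    HasDerivAt (psi α0 β0) (psiDeriv α0 β0 x) x := by
  have hG := integrable_integral_sqrtPhiDeriv α0 β0
  have h := intervalIntegral.integral_hasDerivAt_of_tendsto_ae_right
    (hG.intervalIntegrable (a := 0) (b := x))
    hG.aestronglyMeasurable.stronglyMeasurableAtFilter
    (((continuousAt_psiDeriv α0 β0 hx).tendsto.mono_left inf_le_left).congr'
      ((integral_sqrtPhiDeriv_ae_eq α0 β0).symm.filter_mono inf_le_right))
  refine (h.add_const (psi α0 β0 0)).congr_of_eventuallyEq (.of_forall fun y => ?_)
  simp only [← psi_sub_psi]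
  ring

lemma integral_abs_psiDeriv_le : ∫ x, |psiDeriv α0 β0 x| ≤ √2 + log (1 + √2) := by
  have hint := integrable_uncurry_sqrtPhiDeriv α0 β0
  calc ∫ x, |psiDeriv α0 β0 x|
      = ∫ x, ‖∫ t in Set.Ioc 0 1, sqrtPhiDeriv α0 β0 t x‖ :=
        integral_congr_ae ((integral_sqrtPhiDeriv_ae_eq α0 β0).symm.fun_comp norm)
    _ ≤ ∫ x, ∫ t in Set.Ioc 0 1, ‖sqrtPhiDeriv α0 β0 t x‖ :=
        integral_mono (integrable_integral_sqrtPhiDeriv α0 β0).norm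
          hint.norm.integral_prod_right fun x => norm_integral_le_integral_norm _
    _ = ∫ t in Set.Ioc 0 1, ∫ x, ‖sqrtPhiDeriv α0 β0 t x‖ :=
        (integral_integral_swap hint.norm).symm
    _ = √2 + log (1 + √2) := by
        simp only [integral_norm_sqrtPhiDeriv]
        rw [← intervalIntegral.integral_of_le zero_le_one, integral_two_mul_sqrt_one_add_sq]

end Phi

/-- Lemma 3.0 (i): `ψ` is differentiable at all but finitely many points of `pr₂𝒟`
and `∫_{pr₂𝒟} |ψ'(x)| dx ≤ √2 + ln(1+√2)`. -/
theorem psi_derivative_integral_bound (α0 β0 : ℝ) :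
    ∃ S : Set ℝ, S.Finite ∧
      (∀ x ∈ pr2Dom α0 β0 \ S, DifferentiableAt ℝ (psi α0 β0) x) ∧
      ∫ x in pr2Dom α0 β0, |deriv (psi α0 β0) x| ≤
        Real.sqrt 2 + Real.log (1 + Real.sqrt 2) := by
  have hae : (fun x => |deriv (psi α0 β0) x|) =ᵐ[volume] fun x => |psiDeriv α0 β0 x| := by
    filter_upwards [(finite_phiDiscr_eq_zero α0 β0).measure_zero volume |> compl_mem_ae_iff.2]
      with x hx
    rw [(hasDerivAt_psi α0 β0 hx).deriv]
  have hint : Integrable fun x => |deriv (psi α0 β0) x| :=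
    ((integrable_integral_sqrtPhiDeriv α0 β0).congr (integral_sqrtPhiDeriv_ae_eq α0 β0)).abs.congr
      hae.symm
  refine ⟨{x | phiDiscr α0 β0 x = 0}, finite_phiDiscr_eq_zero α0 β0,
    fun x hx => (hasDerivAt_psi α0 β0 hx.2).differentiableAt, ?_⟩
  calc ∫ x in pr2Dom α0 β0, |deriv (psi α0 β0) x|
      ≤ ∫ x, |deriv (psi α0 β0) x| :=
        setIntegral_le_integral hint (.of_forall fun x => abs_nonneg _)
    _ = ∫ x, |psiDeriv α0 β0 x| := integral_congr_ae hae
    _ ≤ √2 + log (1 + √2) := integral_abs_psiDeriv_le α0 β0
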